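/- arXiv:1805.02954 — 5 statements merged into one kernel-verified Lean document; each statement's English description precedes it below -/
import Mathlib

section
/- Suppose c : X* → ℝ satisfies |(c,η)| ≤ K_c M_c^{|η|} for all η ∈ X* with constants K_c, M_c > 0. Then for every R̂ with 0 < R̂ < 1/(2 M_c (m+1)) and every sequence û with sup_N |û(N)| ≤ R̂, the series Σ_{η∈X*} (c,η) S_η[û](N) converges absolutely for every N ≥ 1, with Σ_η |(c,η)| |S_η[û](N)| ≤ K_c 2^{N−1} / (1 − 2 M_c (m+1) R̂). -/
open scoped BigOperators

namespace FliessStmt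

/-- Words over the alphabet `X = {x_0, …, x_m}`. -/
abbrev Word (m : ℕ) := List (Fin (m + 1))

noncomputable section

/-- Iterated sums: `S_∅[û](N) = 1`,
`S_{x_i η}[û](N) = Σ_{k=1}^N û_i(k) S_η[û](k)`. -/
def itS (m : ℕ) (u : ℕ → Fin (m + 1) → ℝ) : Word m → ℕ → ℝ
  | [], _ => 1
  | i :: η, N => ∑ k ∈ Finset.Icc 1 N, u k i * itS m u η k

/-- The weighted count of all words over a finite alphabet is a geometric series. -/
theorem hasSum_pow_length (α : Type*) [Fintype α] {r : ℝ} (hr : 0 ≤ r)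
    (hr1 : Fintype.card α * r < 1) :
    HasSum (fun η : List α => r ^ η.length) (1 - Fintype.card α * r)⁻¹ := by
  have hfiber (n : ℕ) : HasSum (fun v : List.Vector α n => r ^ v.1.length)
      ((Fintype.card α * r) ^ n) := by
    have h := hasSum_fintype (fun v : List.Vector α n => r ^ v.1.length)
    have hlen : ∀ v : List.Vector α n, r ^ v.1.length = r ^ n := fun v => by rw [v.2]
    simpa [hlen, card_vector, mul_pow] using h
  have hgeom := hasSum_geometric_of_lt_one (mul_nonneg (Nat.cast_nonneg _) hr) hr1
  let e : (Σ n, List.Vector α n) ≃ List α := Equiv.sigmaFiberEquiv List.length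
  rw [← e.hasSum_iff]
  have hsummable : Summable ((fun η : List α => r ^ η.length) ∘ e) := by
    refine (summable_sigma_of_nonneg fun _ => pow_nonneg hr _).2
      ⟨fun n => (hfiber n).summable, ?_⟩
    exact hgeom.summable.congr fun n => (hfiber n).tsum_eq.symm
  rw [← (hsummable.hasSum.sigma hfiber).unique hgeom]
  exact hsummable.hasSum

theorem abs_itS_succ_le (m : ℕ) (u : ℕ → Fin (m + 1) → ℝ) {R : ℝ} (hR0 : 0 ≤ R)
    (hu : ∀ N, 1 ≤ N → ∀ i, |u N i| ≤ R) (η : Word m) (N : ℕ) :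
    |itS m u η (N + 1)| ≤ (2 * R) ^ η.length * 2 ^ N := by
  induction η generalizing N with
  | nil => simpa [itS] using one_le_pow₀ (one_le_two : (1 : ℝ) ≤ 2)
  | cons i η ih =>
    have hgeom : ∑ k ∈ Finset.range (N + 1), (2 : ℝ) ^ k ≤ 2 * 2 ^ N := by
      rw [geom_sum_eq (by norm_num), pow_succ]
      linarith
    have hsum : itS m u (i :: η) (N + 1)
        = ∑ k ∈ Finset.range (N + 1), u (k + 1) i * itS m u η (k + 1) := by
      rw [itS, Finset.range_eq_Ico, Finset.sum_Ico_add' (fun k => u k i * itS m u η k)]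
      rfl
    calc |itS m u (i :: η) (N + 1)|
        ≤ ∑ k ∈ Finset.range (N + 1), R * ((2 * R) ^ η.length * 2 ^ k) := by
          rw [hsum]
          refine (Finset.abs_sum_le_sum_abs _ _).trans (Finset.sum_le_sum fun k _ => ?_)
          rw [abs_mul]
          exact mul_le_mul (hu _ k.succ_pos i) (ih k) (abs_nonneg _) hR0
      _ = R * (2 * R) ^ η.length * ∑ k ∈ Finset.range (N + 1), (2 : ℝ) ^ k := by
          rw [Finset.mul_sum]
          exact Finset.sum_congr rfl fun k _ => by ring
      _ ≤ R * (2 * R) ^ η.length * (2 * 2 ^ N) := by gcongr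
      _ = (2 * R) ^ (i :: η).length * 2 ^ N := by
          rw [List.length_cons, pow_succ]
          ring

/-- If `|(c,η)| ≤ K M^{|η|}` and `0 < R̂ < 1/(2M(m+1))`, then for
every input bounded by `R̂` the series `Σ_η (c,η) S_η[û](N)` converges absolutely
for every `N ≥ 1`, with `Σ_η |(c,η) S_η[û](N)| ≤ K 2^{N−1}/(1 − 2M(m+1)R̂)`. -/
theorem global_growth_gives_local_convergence (m : ℕ) (c : Word m → ℝ) (K M : ℝ)
    (hK : 0 < K) (hM : 0 < M) (hc : ∀ η : Word m, |c η| ≤ K * M ^ η.length)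
    (R : ℝ) (hR0 : 0 < R) (hR : R < 1 / (2 * M * ((m : ℝ) + 1)))
    (u : ℕ → Fin (m + 1) → ℝ) (hu : ∀ N, 1 ≤ N → ∀ i, |u N i| ≤ R) :
    ∀ N : ℕ, 1 ≤ N →
      Summable (fun η : Word m => |c η * itS m u η N|) ∧
      ∑' η : Word m, |c η * itS m u η N|
        ≤ K * 2 ^ (N - 1) / (1 - 2 * M * ((m : ℝ) + 1) * R) := by
  intro N hN
  obtain ⟨N, rfl⟩ := Nat.exists_eq_add_of_le' hN
  have hr1 : (Fintype.card (Fin (m + 1)) : ℝ) * (2 * M * R) < 1 := by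
    rw [lt_div_iff₀ (by positivity)] at hR
    rw [Fintype.card_fin]
    push_cast
    linarith
  have hbound (η : Word m) : |c η * itS m u η (N + 1)| ≤ K * 2 ^ N * (2 * M * R) ^ η.length :=
    calc |c η * itS m u η (N + 1)|
        ≤ (K * M ^ η.length) * ((2 * R) ^ η.length * 2 ^ N) := by
          rw [abs_mul]
          exact mul_le_mul (hc η) (abs_itS_succ_le m u hR0.le hu η N) (abs_nonneg _)
            (by positivity)
      _ = K * 2 ^ N * (2 * M * R) ^ η.length := by
          simp only [mul_pow]
          ring
  have hmajor := (hasSum_pow_length (Fin (m + 1)) (by positivity) hr1).mul_left (K * 2 ^ N)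
  have hsummable : Summable (fun η : Word m => |c η * itS m u η (N + 1)|) :=
    hmajor.summable.of_nonneg_of_le (fun _ => abs_nonneg _) hbound
  refine ⟨hsummable, (hsummable.tsum_le_tsum hbound hmajor.summable).trans_eq ?_⟩
  rw [hmajor.tsum_eq, Fintype.card_fin, Nat.add_sub_cancel, div_eq_mul_inv]
  push_cast
  ring_nf

end

end FliessStmt
end

section
/- Suppose c : X* → ℝ satisfies |(c,η)| ≤ K_c M_c^{|η|} / |η|! for all η ∈ X* with constants K_c, M_c > 0. Then for every bounded sequence û with ‖û‖_∞ := sup_N max_i |û_i(N)| < ∞, the series Σ_{η∈X*} (c,η) S_η[û](N) converges absolutely for every N ≥ 1, with Σ_η |(c,η)| |S_η[û](N)| ≤ K_c 2^{N−1} exp(2 M_c (m+1) ‖û‖_∞). -/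
open scoped BigOperators

namespace FliessStmt

noncomputable section

/-- The geometric bound `|S_η[û](N)| ≤ 2^{N-1} (2U)^{|η|}`. -/
theorem abs_itS_le (m : ℕ) (u : ℕ → Fin (m + 1) → ℝ) (U : ℝ)
    (hu : ∀ N, 1 ≤ N → ∀ i, |u N i| ≤ U) (η : Word m) (N : ℕ) (hN : 1 ≤ N) :
    |itS m u η N| ≤ 2 ^ (N - 1) * (2 * U) ^ η.length := by
  have hU : 0 ≤ U := (abs_nonneg _).trans (hu 1 le_rfl 0)
  induction η generalizing N with
  | nil => simpa [itS] using one_le_pow₀ (one_le_two (α := ℝ))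
  | cons i η ih =>
    have hgeom : ∀ n : ℕ, ∑ k ∈ Finset.Icc 1 n, (2 : ℝ) ^ (k - 1) = 2 ^ n - 1 := by
      intro n
      induction n with
      | zero => simp
      | succ n ihn =>
        rw [Finset.sum_Icc_succ_top (by omega), ihn, Nat.add_sub_cancel]
        ring
    calc |itS m u (i :: η) N|
        ≤ ∑ k ∈ Finset.Icc 1 N, |u k i * itS m u η k| := Finset.abs_sum_le_sum_abs _ _
      _ ≤ ∑ k ∈ Finset.Icc 1 N, U * (2 ^ (k - 1) * (2 * U) ^ η.length) := by
          refine Finset.sum_le_sum fun k hk => ?_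
          have hk1 := (Finset.mem_Icc.mp hk).1
          rw [abs_mul]
          exact mul_le_mul (hu k hk1 i) (ih k hk1) (abs_nonneg _) hU
      _ = (2 ^ N - 1) * (U * (2 * U) ^ η.length) := by
          rw [← hgeom, Finset.sum_mul]
          exact Finset.sum_congr rfl fun k _ => by ring
      _ ≤ 2 ^ N * (U * (2 * U) ^ η.length) := by
          gcongr
          linarith
      _ = 2 ^ (N - 1) * (2 * U) ^ (i :: η).length := by
          obtain ⟨n, rfl⟩ := Nat.exists_eq_add_of_le' hN
          simp only [List.length_cons, Nat.add_sub_cancel]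
          ring

/-- The exponential series over all words of a finite alphabet. -/
theorem hasSum_list_pow_length_div_factorial (α : Type*) [Fintype α] {a : ℝ} (ha : 0 ≤ a) :
    HasSum (fun η : List α => a ^ η.length / (Nat.factorial η.length : ℝ))
      (Real.exp (Fintype.card α * a)) := by
  let e : (Σ n, List.Vector α n) ≃ List α := Equiv.sigmaFiberEquiv List.length
  rw [← e.hasSum_iff]
  have hterm : ∀ p : Σ n, List.Vector α n,
      ((fun η : List α => a ^ η.length / (Nat.factorial η.length : ℝ)) ∘ e) p
        = a ^ p.1 / (Nat.factorial p.1 : ℝ) := by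
    rintro ⟨n, η, rfl⟩
    rfl
  rw [funext hterm]
  have hfiber : ∀ n : ℕ, HasSum (fun _ : List.Vector α n => a ^ n / (Nat.factorial n : ℝ))
      ((Fintype.card α * a) ^ n / (Nat.factorial n : ℝ)) := by
    intro n
    convert hasSum_fintype (fun _ : List.Vector α n => a ^ n / (Nat.factorial n : ℝ)) using 1
    simp [card_vector, mul_pow, mul_div_assoc]
  have hexp : HasSum (fun n : ℕ => (Fintype.card α * a) ^ n / (Nat.factorial n : ℝ))
      (Real.exp (Fintype.card α * a)) := by
    rw [Real.exp_eq_exp_ℝ]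
    exact NormedSpace.expSeries_div_hasSum_exp _
  have hsum : Summable fun p : Σ n, List.Vector α n => a ^ p.1 / (Nat.factorial p.1 : ℝ) := by
    refine (summable_sigma_of_nonneg fun p => by positivity).mpr
      ⟨fun n => (hfiber n).summable, ?_⟩
    simpa only [(hfiber _).tsum_eq] using hexp.summable
  exact hexp.sigma_of_hasSum hfiber hsum

/-- If `|(c,η)| ≤ K M^{|η|}/|η|!`, then for every bounded input
(with bound `U ≥ ‖û‖_∞`) the series `Σ_η (c,η) S_η[û](N)` converges absolutely for
every `N ≥ 1`, with `Σ_η |(c,η) S_η[û](N)| ≤ K 2^{N−1} exp(2M(m+1)U)`. -/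
theorem factorial_decay_gives_global_convergence (m : ℕ) (c : Word m → ℝ) (K M : ℝ)
    (hK : 0 < K) (hM : 0 < M)
    (hc : ∀ η : Word m, |c η| ≤ K * M ^ η.length / (Nat.factorial η.length : ℝ))
    (u : ℕ → Fin (m + 1) → ℝ) (U : ℝ) (hu : ∀ N, 1 ≤ N → ∀ i, |u N i| ≤ U) :
    ∀ N : ℕ, 1 ≤ N →
      Summable (fun η : Word m => |c η * itS m u η N|) ∧
      ∑' η : Word m, |c η * itS m u η N|
        ≤ K * 2 ^ (N - 1) * Real.exp (2 * M * ((m : ℝ) + 1) * U) := by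
  intro N hN
  have hU : 0 ≤ U := (abs_nonneg _).trans (hu 1 le_rfl 0)
  have hle : ∀ η : Word m, |c η * itS m u η N| ≤
      K * 2 ^ (N - 1) * ((2 * M * U) ^ η.length / (Nat.factorial η.length : ℝ)) := by
    intro η
    rw [abs_mul]
    calc |c η| * |itS m u η N|
        ≤ (K * M ^ η.length / (Nat.factorial η.length : ℝ)) *
            (2 ^ (N - 1) * (2 * U) ^ η.length) :=
          mul_le_mul (hc η) (abs_itS_le m u U hu η N hN) (abs_nonneg _) (by positivity)
      _ = _ := by
          rw [show 2 * M * U = M * (2 * U) by ring, mul_pow M]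
          ring
  have hsum := (hasSum_list_pow_length_div_factorial (Fin (m + 1))
    (a := 2 * M * U) (by positivity)).mul_left (K * 2 ^ (N - 1))
  have hs : Summable fun η : Word m => |c η * itS m u η N| :=
    hsum.summable.of_nonneg_of_le (fun _ => abs_nonneg _) hle
  refine ⟨hs, (hs.tsum_le_tsum hle hsum.summable).trans_eq ?_⟩
  rw [hsum.tsum_eq, Fintype.card_fin]
  push_cast
  ring_nf

end

end FliessStmt
end

section
/- If the coefficients are (c,η) = K_c M_c^{|η|} |η|! for all η ∈ X* (K_c, M_c > 0), and the input is constant, û_i(N) = R̂ > 0 for all N ≥ 1 and all i = 0,…,m, then for every fixed N ≥ 1 the series Σ_{η∈X*} (c,η) S_η[û](N) = K_c Σ_{j=0}^∞ (M_c (m+1) R̂)^j · j! · C(N−1+j, j) diverges, for every value of R̂ > 0 (in particular even when R̂ < 1/(M_c(m+1))). -/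
open scoped BigOperators

namespace FliessStmt

noncomputable section

/-- A series dominating `K a^j j!` with `K, a > 0` diverges. -/
theorem not_summable_of_pow_mul_factorial_le {K a : ℝ} (hK : 0 < K) (ha : 0 < a) {f : ℕ → ℝ}
    (hf : ∀ j, K * a ^ j * (Nat.factorial j : ℝ) ≤ f j) : ¬ Summable f := by
  intro h
  have hlim := h.tendsto_atTop_zero.mul (FloorSemiring.tendsto_pow_div_factorial_atTop a⁻¹)
  rw [mul_zero] at hlim
  refine hK.not_ge (ge_of_tendsto' hlim fun j => ?_)
  have hfac : (0 : ℝ) < Nat.factorial j := by exact_mod_cast Nat.factorial_pos j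
  calc K = K * a ^ j * (Nat.factorial j : ℝ) * (a⁻¹ ^ j / (Nat.factorial j : ℝ)) := by
        field_simp
        rw [← mul_pow, mul_one_div_cancel ha.ne', one_pow]
    _ ≤ f j * (a⁻¹ ^ j / (Nat.factorial j : ℝ)) := by gcongr; exact hf j

/-- For the constant input `R ≥ 0`, iterated sums are at least `R^{|η|}`. -/
theorem pow_length_le_itS {m : ℕ} {R : ℝ} (hR : 0 ≤ R) {u : ℕ → Fin (m + 1) → ℝ}
    (hu : ∀ N, 1 ≤ N → ∀ i, u N i = R) (η : Word m) {N : ℕ} (hN : 1 ≤ N) :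
    R ^ η.length ≤ itS m u η N := by
  induction η generalizing N with
  | nil => simp [itS]
  | cons i η ih =>
    have hterm : ∀ k, 1 ≤ k → R ^ (η.length + 1) ≤ u k i * itS m u η k := fun k hk => by
      rw [hu k hk i, pow_succ']
      exact mul_le_mul_of_nonneg_left (ih hk) hR
    rw [List.length_cons, itS]
    refine (hterm N hN).trans (Finset.single_le_sum (f := fun k => u k i * itS m u η k)
      (fun k hk => ?_) (Finset.mem_Icc.2 ⟨hN, le_rfl⟩))
    exact (pow_nonneg hR _).trans (hterm k (Finset.mem_Icc.1 hk).1)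

/-- With coefficients `(c,η) = K M^{|η|} |η|!` and the constant
input `û_i(N) = R̂ > 0`, the series `Σ_η (c,η) S_η[û](N)`, which groups by word
length into `K Σ_j (M(m+1)R̂)^j j! C(N−1+j, j)`, diverges for every `R̂ > 0`
(in particular even when `R̂ < 1/(M(m+1))`). -/
theorem local_growth_divergence (m : ℕ) (K M R : ℝ)
    (hK : 0 < K) (hM : 0 < M) (hR : 0 < R)
    (u : ℕ → Fin (m + 1) → ℝ) (hu : ∀ N, 1 ≤ N → ∀ i, u N i = R) :
    ∀ N : ℕ, 1 ≤ N →
      ¬ Summable (fun η : Word m =>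
          (K * M ^ η.length * (Nat.factorial η.length : ℝ)) * itS m u η N) ∧
      ¬ Summable (fun j : ℕ =>
          K * (M * ((m : ℝ) + 1) * R) ^ j * (Nat.factorial j : ℝ)
            * (Nat.choose (N - 1 + j) j : ℝ)) := by
  intro N hN
  constructor
  · intro h
    refine not_summable_of_pow_mul_factorial_le hK (mul_pos hM hR) (fun j => ?_)
      (h.comp_injective (List.replicate_left_injective (0 : Fin (m + 1))))
    have hS := pow_length_le_itS hR.le hu (List.replicate j 0) hN
    simp only [Function.comp_apply, List.length_replicate] at hS ⊢
    calc K * (M * R) ^ j * (Nat.factorial j : ℝ)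
        = K * M ^ j * (Nat.factorial j : ℝ) * R ^ j := by rw [mul_pow]; ring
      _ ≤ _ := by gcongr
  · have ha : 0 < M * ((m : ℝ) + 1) * R := by positivity
    refine not_summable_of_pow_mul_factorial_le hK ha fun j => ?_
    refine le_mul_of_one_le_right (by positivity) ?_
    exact_mod_cast Nat.choose_pos (Nat.le_add_left j (N - 1))

end

end FliessStmt
end

section
/- For any words η, ξ ∈ X̄*, any sequence û, and any N ≥ 1, the product of iterated sums satisfies S_η[û](N) · S_ξ[û](N) = Σ_{ν∈X̄*} (η ⊛ ξ, ν) S_ν[û](N) = S_{η⊛ξ}[û](N), where ⊛ is the quasi-shuffle product with recursion (a v) ⊛ (b w) = a(v ⊛ (b w)) + b((a v) ⊛ w) − [a b](v ⊛ w). -/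
open scoped BigOperators

namespace QShuffleExt

/-- The extended alphabet `X̄`: letters `x_A` are indexed by nonempty finite
multisets `A` of indices from `{0, 1, …, m}`; `x_i := x_{{i}}`. -/
abbrev Letter (m : ℕ) := {A : Multiset (Fin (m + 1)) // A ≠ 0}

/-- Words over the extended alphabet. -/
abbrev QWord (m : ℕ) := List (Letter m)

/-- Formal power series over `X̄`. -/
abbrev QSeries (m : ℕ) := QWord m → ℝ

noncomputable section

variable (m : ℕ)

/-- The commutative associative bracket `[x_A x_B] := x_{A ⊎ B}`. -/
def br (a b : Letter m) : Letter m :=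
  ⟨a.1 + b.1, fun h => a.2 (by
    have := congrArg Multiset.card h
    simp at this
    exact this.1)⟩

/-- Left catenation by a letter: `e ↦ a e`. -/
def cat (a : Letter m) (e : QSeries m) : QSeries m := fun ν =>
  match ν with
  | [] => 0
  | b :: ν' => if b = a then e ν' else 0

/-- The quasi-shuffle product of two words:
`(a v) ⊛ (b w) = a(v ⊛ (b w)) + b((a v) ⊛ w) − [a b](v ⊛ w)`,
`∅ ⊛ η = η ⊛ ∅ = η`. -/
def qshw : QWord m → QWord m → QSeries m
  | [], ξ => fun ν => if ν = ξ then 1 else 0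
  | η, [] => fun ν => if ν = η then 1 else 0
  | a :: v, b :: w =>
      cat m a (qshw v (b :: w)) + cat m b (qshw (a :: v) w)
        - cat m (br m a b) (qshw v w)
  termination_by v w => v.length + w.length

/-- The quasi-shuffle product, extended bilinearly to formal power series
(the extension is locally finite, hence well defined). -/
def qshS (c d : QSeries m) : QSeries m := fun ν =>
  ∑ᶠ p : QWord m × QWord m, c p.1 * d p.2 * qshw m p.1 p.2 ν

/-- The left-shift operator `a⁻¹` on series: `a⁻¹(c)(ν) = c(aν)`. -/
def leftShift (a : Letter m) (c : QSeries m) : QSeries m := fun ν => c (a :: ν)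

/-- A subspace of series is stable when it is closed under all left shifts. -/
def ShiftStable (V : Submodule ℝ (QSeries m)) : Prop :=
  ∀ a : Letter m, ∀ x ∈ V, leftShift m a x ∈ V

/-- `c` is a series over the finite sub-alphabet `X₀ ⊂ X̄`: its support only
contains words whose letters lie in `X₀`. -/
def SupportedOn (X₀ : Finset (Letter m)) (c : QSeries m) : Prop :=
  ∀ ν : QWord m, ¬ (∀ a ∈ ν, a ∈ X₀) → c ν = 0

/-- `c` is a rational series over the finite sub-alphabet `X₀ ⊂ X̄`: it is a
series over `X₀` lying in some finite-dimensional subspace stable under all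
left shifts. -/
def IsRationalOn (X₀ : Finset (Letter m)) (c : QSeries m) : Prop :=
  SupportedOn m X₀ c ∧
    ∃ V : Submodule ℝ (QSeries m),
      FiniteDimensional ℝ V ∧ ShiftStable m V ∧ c ∈ V

/-- The set of letters `[X_c X_d] = {[a b] : a ∈ X_c, b ∈ X_d}`. -/
def brSet (Xc Xd : Finset (Letter m)) : Finset (Letter m) :=
  (Xc ×ˢ Xd).image fun p => br m p.1 p.2

/-- Iterated sums over `X̄*`: `S_∅[û](N) = 1`,
`S_{x_A η}[û](N) = Σ_{k=1}^N (Π_{i∈A} û_i(k)) S_η[û](k)` (multiset product with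
multiplicity). -/
def itS (u : ℕ → Fin (m + 1) → ℝ) : QWord m → ℕ → ℝ
  | [], _ => 1
  | A :: η, N => ∑ k ∈ Finset.Icc 1 N, (A.1.map fun i => u k i).prod * itS u η k

variable {m}

theorem support_cat_subset (a : Letter m) (e : QSeries m) :
    Function.support (cat m a e) ⊆ List.cons a '' Function.support e := by
  intro ν hν
  cases ν with
  | nil => simp [cat] at hν
  | cons b ν =>
    by_cases hb : b = a
    · subst hb
      exact ⟨ν, by simpa [cat] using hν, rfl⟩
    · simp [cat, hb] at hν

theorem finite_support_cat (a : Letter m) {e : QSeries m} (he : (Function.support e).Finite) :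
    (Function.support (cat m a e)).Finite :=
  (he.image _).subset (support_cat_subset a e)

theorem finite_support_ite_eq (ξ : QWord m) :
    (Function.support fun ν : QWord m => if ν = ξ then (1 : ℝ) else 0).Finite :=
  (Set.finite_singleton ξ).subset fun ν hν => by
    by_contra h
    simp_all

theorem finite_support_qshw (η ξ : QWord m) : (Function.support (qshw m η ξ)).Finite := by
  fun_induction qshw m η ξ with
  | case1 ξ => exact finite_support_ite_eq ξ
  | case2 η => exact finite_support_ite_eq η
  | case3 a v b w ih₁ ih₂ ih₃ =>
    exact (((finite_support_cat a ih₁).union (finite_support_cat b ih₂)).subset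
      (Function.support_add _ _)).union (finite_support_cat (br m a b) ih₃) |>.subset
      (Function.support_sub _ _)

theorem finite_support_mul_itS (u : ℕ → Fin (m + 1) → ℝ) (N : ℕ) {e : QSeries m}
    (he : (Function.support e).Finite) :
    (Function.support fun ν => e ν * itS m u ν N).Finite :=
  he.subset (Function.support_mul_subset_left _ _)

/-- Left catenation by a letter becomes weighted summation under the iterated-sum pairing. -/
theorem finsum_cat_mul_itS (u : ℕ → Fin (m + 1) → ℝ) (N : ℕ) (a : Letter m) {e : QSeries m}
    (he : (Function.support e).Finite) :
    ∑ᶠ ν, cat m a e ν * itS m u ν N =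
      ∑ k ∈ Finset.Icc 1 N, (a.1.map fun i => u k i).prod * ∑ᶠ ν, e ν * itS m u ν k := by
  have hcat : (Function.support fun ν => cat m a e ν * itS m u ν N) ⊆
      (he.toFinset.map ⟨List.cons a, List.cons_injective⟩ : Finset (QWord m)) := by
    refine (Function.support_mul_subset_left _ _).trans ?_
    simpa using support_cat_subset a e
  have hword (k : ℕ) : ∑ᶠ ν, e ν * itS m u ν k = ∑ ν ∈ he.toFinset, e ν * itS m u ν k :=
    finsum_eq_sum_of_support_subset _ (by simp)
  rw [finsum_eq_sum_of_support_subset _ hcat, Finset.sum_map]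
  simp only [hword, Function.Embedding.coeFn_mk, cat, if_true, itS, Finset.mul_sum]
  rw [Finset.sum_comm]
  exact Finset.sum_congr rfl fun k _ => Finset.sum_congr rfl fun ν _ => by ring

theorem finsum_ite_eq_mul_itS (u : ℕ → Fin (m + 1) → ℝ) (N : ℕ) (ξ : QWord m) :
    ∑ᶠ ν, (if ν = ξ then (1 : ℝ) else 0) * itS m u ν N = itS m u ξ N := by
  rw [finsum_eq_single _ ξ fun ν hν => by simp [hν]]
  simp

/-- The product of two partial sums, split according to which summation index is larger. -/
theorem sum_Icc_mul_sum_Icc {R : Type*} [CommRing R] (f g : ℕ → R) (N : ℕ) :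
    (∑ k ∈ Finset.Icc 1 N, f k) * ∑ k ∈ Finset.Icc 1 N, g k =
      ∑ k ∈ Finset.Icc 1 N, f k * ∑ l ∈ Finset.Icc 1 k, g l +
        ∑ k ∈ Finset.Icc 1 N, g k * ∑ l ∈ Finset.Icc 1 k, f l -
        ∑ k ∈ Finset.Icc 1 N, f k * g k := by
  induction N with
  | zero => simp
  | succ N ih =>
    simp only [Finset.sum_Icc_succ_top (Nat.le_add_left 1 N)]
    linear_combination ih

/-- The product formula for iterated sums, at every `N`. -/
theorem itS_mul_itS (u : ℕ → Fin (m + 1) → ℝ) (η ξ : QWord m) (N : ℕ) :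
    itS m u η N * itS m u ξ N = ∑ᶠ ν : QWord m, qshw m η ξ ν * itS m u ν N := by
  fun_induction qshw m η ξ generalizing N with
  | case1 ξ => rw [finsum_ite_eq_mul_itS, itS, one_mul]
  | case2 η => rw [finsum_ite_eq_mul_itS, itS, mul_one]
  | case3 a v b w ih₁ ih₂ ih₃ =>
    have h₁ := finite_support_cat a (finite_support_qshw v (b :: w))
    have h₂ := finite_support_cat b (finite_support_qshw (a :: v) w)
    have h₃ := finite_support_cat (br m a b) (finite_support_qshw v w)
    simp only [Pi.add_apply, Pi.sub_apply, add_mul, sub_mul]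
    rw [finsum_sub_distrib
        (((finite_support_mul_itS u N h₁).union (finite_support_mul_itS u N h₂)).subset
          (Function.support_add _ _)) (finite_support_mul_itS u N h₃),
      finsum_add_distrib (finite_support_mul_itS u N h₁) (finite_support_mul_itS u N h₂),
      finsum_cat_mul_itS u N a (finite_support_qshw _ _),
      finsum_cat_mul_itS u N b (finite_support_qshw _ _),
      finsum_cat_mul_itS u N (br m a b) (finite_support_qshw _ _)]
    simp only [← ih₁, ← ih₂, ← ih₃, itS]
    rw [sum_Icc_mul_sum_Icc]
    congr 1
    · congr 1 <;> exact Finset.sum_congr rfl fun k _ => by ring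
    · refine Finset.sum_congr rfl fun k _ => ?_
      simp only [br, Multiset.map_add, Multiset.prod_add]
      ring

/-- Products of iterated sums are iterated sums of the
quasi-shuffle: `S_η[û](N) S_ξ[û](N) = Σ_ν (η ⊛ ξ, ν) S_ν[û](N) = S_{η⊛ξ}[û](N)`. -/
theorem iterated_sum_product (m : ℕ) (u : ℕ → Fin (m + 1) → ℝ)
    (η ξ : QWord m) (N : ℕ) (hN : 1 ≤ N) :
    itS m u η N * itS m u ξ N = ∑ᶠ ν : QWord m, qshw m η ξ ν * itS m u ν N := by
  exact itS_mul_itS u η ξ N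

end

end QShuffleExt
end

section
/- For any u ∈ L_1^m[t_0, t_1] (with u_0 := 1), any words η, ν ∈ X*, and any t ∈ [t_0, t_1], the product of iterated integrals satisfies E_η[u](t, t_0) · E_ν[u](t, t_0) = Σ_{κ∈X*} (η ⧢ ν, κ) E_κ[u](t, t_0), the sum being finite since (η ⧢ ν, κ) = 0 unless |κ| = |η| + |ν|. -/
open scoped BigOperators

namespace FliessStmt

/-- Formal power series over `X`. -/
abbrev Series (m : ℕ) := Word m → ℝ

noncomputable section

variable (m : ℕ)

/-- Left catenation by the letter `x_i`: `e ↦ x_i e`. -/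
def cat (i : Fin (m + 1)) (e : Series m) : Series m := fun ν =>
  match ν with
  | [] => 0
  | j :: ν' => if j = i then e ν' else 0

/-- The shuffle product of two words, as a polynomial:
`(x_i η) ⧢ (x_j ξ) = x_i(η ⧢ (x_j ξ)) + x_j((x_i η) ⧢ ξ)`, `∅ ⧢ η = η ⧢ ∅ = η`;
`shw η ν κ` is the coefficient `(η ⧢ ν, κ)`. -/
def shw : Word m → Word m → Series m
  | [], ξ => fun ν => if ν = ξ then 1 else 0
  | η, [] => fun ν => if ν = η then 1 else 0
  | i :: η, j :: ξ => cat m i (shw η (j :: ξ)) + cat m j (shw (i :: η) ξ)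
  termination_by η ξ => η.length + ξ.length

/-- Iterated integrals: `E_∅[u](t,t₀) = 1`,
`E_{x_i η}[u](t,t₀) = ∫_{t₀}^t u_i(τ) E_η[u](τ,t₀) dτ`. -/
def E (u : ℝ → Fin (m + 1) → ℝ) (t₀ : ℝ) : Word m → ℝ → ℝ
  | [], _ => 1
  | i :: η, t => ∫ τ in t₀..t, u τ i * E u t₀ η τ

open MeasureTheory Set

/-- The product of the primitives of two integrable functions, by integration by parts. -/
theorem integral_mul_integral_eq_add {f g : ℝ → ℝ} {a b : ℝ}
    (hf : IntervalIntegrable f volume a b) (hg : IntervalIntegrable g volume a b) :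
    (∫ τ in a..b, f τ) * (∫ τ in a..b, g τ) =
      (∫ τ in a..b, f τ * ∫ σ in a..τ, g σ) + ∫ τ in a..b, g τ * ∫ σ in a..τ, f σ := by
  have hF := hf.absolutelyContinuousOnInterval_intervalIntegral (c := a) left_mem_uIcc
  have hG := hg.absolutelyContinuousOnInterval_intervalIntegral (c := a) left_mem_uIcc
  have key := hF.integral_deriv_mul_eq_sub hG
  simp only [intervalIntegral.integral_same, mul_zero, sub_zero] at key
  rw [← key, ← intervalIntegral.integral_add (hf.mul_continuousOn hG.continuousOn)
    (hg.mul_continuousOn hF.continuousOn)]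
  apply intervalIntegral.integral_congr_ae
  filter_upwards [hf.ae_hasDerivAt_integral, hg.ae_hasDerivAt_integral] with x hfx hgx hx
  have hx' := uIoc_subset_uIcc hx
  rw [(hfx hx' a left_mem_uIcc).deriv, (hgx hx' a left_mem_uIcc).deriv,
    mul_comm (g x)]

theorem shw_nil_left (ξ : Word m) : shw m [] ξ = fun κ => if κ = ξ then 1 else 0 := by
  rw [shw]

theorem shw_nil_right (η : Word m) : shw m η [] = fun κ => if κ = η then 1 else 0 := by
  cases η <;> simp [shw]

theorem shw_cons_cons (i j : Fin (m + 1)) (η ξ : Word m) :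
    shw m (i :: η) (j :: ξ) =
      cat m i (shw m η (j :: ξ)) + cat m j (shw m (i :: η) ξ) := by
  rw [shw]

theorem cat_eq_zero_of_length_ne {i : Fin (m + 1)} {p : Series m} {n : ℕ}
    (hp : ∀ κ : Word m, κ.length ≠ n → p κ = 0) (κ : Word m) (hκ : κ.length ≠ n + 1) :
    cat m i p κ = 0 := by
  cases κ with
  | nil => rfl
  | cons j κ =>
    have : p κ = 0 := hp κ (by simpa using hκ)
    simp [cat, this]

/-- The shuffle product of two words is homogeneous. -/
theorem shw_eq_zero_of_length_ne (η ν κ : Word m) (hκ : κ.length ≠ η.length + ν.length) :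
    shw m η ν κ = 0 := by
  induction η generalizing ν κ with
  | nil =>
    have : κ ≠ ν := by rintro rfl; simp at hκ
    simp [shw_nil_left, this]
  | cons i η ihη =>
    induction ν generalizing κ with
    | nil =>
      have : κ ≠ i :: η := by rintro rfl; simp at hκ
      simp [shw_nil_right, this]
    | cons j ν ihν =>
      rw [shw_cons_cons, Pi.add_apply,
        cat_eq_zero_of_length_ne m (ihη (j :: ν)) κ (by simp at hκ ⊢; omega),
        cat_eq_zero_of_length_ne m ihν κ (by simp at hκ ⊢; omega), add_zero]

theorem finite_support_shw (η ν : Word m) : (Function.support (shw m η ν)).Finite :=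
  (List.finite_length_eq (Fin (m + 1)) (η.length + ν.length)).subset fun κ hκ => by
    by_contra h
    exact hκ (shw_eq_zero_of_length_ne m η ν κ h)

theorem support_cat_subset (i : Fin (m + 1)) (p : Series m) :
    Function.support (cat m i p) ⊆ List.cons i '' Function.support p := by
  rintro (_ | ⟨j, κ⟩) hκ
  · exact absurd rfl hκ
  · by_cases hj : j = i
    · subst hj
      exact ⟨κ, by simpa [cat] using hκ, rfl⟩
    · simp [cat, hj] at hκ

section Integrals

variable {m} {t₀ t₁ : ℝ} {u : ℝ → Fin (m + 1) → ℝ}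

theorem continuousOn_E (hint : ∀ i, IntervalIntegrable (fun τ => u τ i) volume t₀ t₁)
    (η : Word m) : ContinuousOn (E m u t₀ η) (uIcc t₀ t₁) := by
  induction η with
  | nil => exact continuousOn_const
  | cons i η ih =>
    exact (((hint i).mul_continuousOn ih).absolutelyContinuousOnInterval_intervalIntegral
      left_mem_uIcc).continuousOn

theorem intervalIntegrable_mul_E
    (hint : ∀ i, IntervalIntegrable (fun τ => u τ i) volume t₀ t₁)
    (i : Fin (m + 1)) (η : Word m) {t : ℝ} (ht : t ∈ uIcc t₀ t₁) :
    IntervalIntegrable (fun τ => u τ i * E m u t₀ η τ) volume t₀ t :=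
  ((hint i).mul_continuousOn (continuousOn_E hint η)).mono_set
    (uIcc_subset_uIcc left_mem_uIcc ht)

/-- Left catenation by `x_i` corresponds to integration against `u_i`. -/
theorem finsum_cat_mul_E (hint : ∀ i, IntervalIntegrable (fun τ => u τ i) volume t₀ t₁)
    (i : Fin (m + 1)) {p : Series m} (hp : (Function.support p).Finite)
    {t : ℝ} (ht : t ∈ uIcc t₀ t₁) :
    ∑ᶠ κ : Word m, cat m i p κ * E m u t₀ κ t =
      ∫ τ in t₀..t, u τ i * ∑ᶠ κ : Word m, p κ * E m u t₀ κ τ := by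
  have hright (τ : ℝ) : ∑ᶠ κ : Word m, p κ * E m u t₀ κ τ =
      ∑ κ ∈ hp.toFinset, p κ * E m u t₀ κ τ :=
    finsum_eq_sum_of_support_subset _ fun κ hκ => by
      simpa using left_ne_zero_of_mul hκ
  have hleft : ∑ᶠ κ : Word m, cat m i p κ * E m u t₀ κ t =
      ∑ κ ∈ hp.toFinset.map ⟨List.cons i, List.cons_injective⟩,
        cat m i p κ * E m u t₀ κ t :=
    finsum_eq_sum_of_support_subset _ fun κ hκ => by
      simpa using support_cat_subset m i p (left_ne_zero_of_mul hκ)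
  simp_rw [hright, hleft, Finset.sum_map, Finset.mul_sum, mul_left_comm (u _ i)]
  rw [intervalIntegral.integral_finsetSum fun κ _ =>
    (intervalIntegrable_mul_E hint i κ ht).const_mul (p κ)]
  refine Finset.sum_congr rfl fun κ _ => ?_
  rw [intervalIntegral.integral_const_mul]
  simp [cat, E]

theorem finsum_ite_mul_E (η : Word m) (t : ℝ) :
    ∑ᶠ κ : Word m, (if κ = η then 1 else 0) * E m u t₀ κ t = E m u t₀ η t := by
  rw [finsum_eq_single _ η fun κ hκ => by simp [hκ]]
  simp

theorem finsum_shw_cons_cons (hint : ∀ i, IntervalIntegrable (fun τ => u τ i) volume t₀ t₁)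
    (i j : Fin (m + 1)) (η ν : Word m) {t : ℝ} (ht : t ∈ uIcc t₀ t₁) :
    ∑ᶠ κ : Word m, shw m (i :: η) (j :: ν) κ * E m u t₀ κ t =
      (∫ τ in t₀..t, u τ i * ∑ᶠ κ : Word m, shw m η (j :: ν) κ * E m u t₀ κ τ) +
        ∫ τ in t₀..t, u τ j * ∑ᶠ κ : Word m, shw m (i :: η) ν κ * E m u t₀ κ τ := by
  have hfin (k : Fin (m + 1)) (α β : Word m) :
      (Function.support fun κ => cat m k (shw m α β) κ * E m u t₀ κ t).Finite :=
    (((finite_support_shw m α β).image _).subset (support_cat_subset m k _)).subset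
      fun κ hκ => left_ne_zero_of_mul hκ
  rw [← finsum_cat_mul_E hint i (finite_support_shw m _ _) ht,
    ← finsum_cat_mul_E hint j (finite_support_shw m _ _) ht,
    ← finsum_add_distrib (hfin i _ _) (hfin j _ _)]
  simp_rw [shw_cons_cons, Pi.add_apply, add_mul]

theorem E_mul_E_eq_finsum (hint : ∀ i, IntervalIntegrable (fun τ => u τ i) volume t₀ t₁)
    (η ν : Word m) {t : ℝ} (ht : t ∈ uIcc t₀ t₁) :
    E m u t₀ η t * E m u t₀ ν t = ∑ᶠ κ : Word m, shw m η ν κ * E m u t₀ κ t := by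
  induction η generalizing ν t with
  | nil => simp_rw [shw_nil_left, finsum_ite_mul_E, E, one_mul]
  | cons i η ihη =>
    induction ν generalizing t with
    | nil => simp_rw [shw_nil_right, finsum_ite_mul_E, E, mul_one]
    | cons j ν ihν =>
      have hsub : uIcc t₀ t ⊆ uIcc t₀ t₁ := uIcc_subset_uIcc left_mem_uIcc ht
      rw [finsum_shw_cons_cons hint i j η ν ht]
      simp only [E]
      rw [integral_mul_integral_eq_add (intervalIntegrable_mul_E hint i η ht)
        (intervalIntegrable_mul_E hint j ν ht)]
      congr 1
      · refine intervalIntegral.integral_congr fun τ hτ => ?_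
        simp only [← ihη (j :: ν) (hsub hτ), E, mul_assoc]
      · refine intervalIntegral.integral_congr fun τ hτ => ?_
        simp only [← ihν (hsub hτ), E]
        ring

end Integrals

/-- For integrable `u` (with `u_0 := 1`), products of iterated
integrals satisfy `E_η[u](t,t₀) E_ν[u](t,t₀) = Σ_κ (η ⧢ ν, κ) E_κ[u](t,t₀)`, the
sum being finite since `(η ⧢ ν, κ) = 0` unless `|κ| = |η| + |ν|`. -/
theorem iterated_integral_product (m : ℕ) (t₀ t₁ : ℝ) (ht : t₀ ≤ t₁)
    (u : ℝ → Fin (m + 1) → ℝ) (hu0 : ∀ τ, u τ 0 = 1)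
    (hint : ∀ i, IntervalIntegrable (fun τ => u τ i) MeasureTheory.volume t₀ t₁)
    (η ν : Word m) (t : ℝ) (htt : t ∈ Set.Icc t₀ t₁) :
    E m u t₀ η t * E m u t₀ ν t = ∑ᶠ κ : Word m, shw m η ν κ * E m u t₀ κ t ∧
    ∀ κ : Word m, κ.length ≠ η.length + ν.length → shw m η ν κ = 0 := by
  exact ⟨E_mul_E_eq_finsum hint η ν (Set.Icc_subset_uIcc htt),
    shw_eq_zero_of_length_ne m η ν⟩

end

end FliessStmt
end
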